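/- For every φ ∈ W there exists a unique global mild solution u of the delay equation ü(t) + k u̇(t) + A u(t) + F(u(t)) + M(u_t) = 0 on [0,∞) with initial datum φ. -/

import Mathlib

open Set Real MeasureTheory
open scoped RealInnerProductSpace

noncomputable section

/-- Euclidean space `ℝⁿ`. -/
abbrev Euc (n : ℕ) := EuclideanSpace ℝ (Fin n)

/-- `(φ, φ')` is a `C¹` pair on `[-h,0]`: `φ'` is the (one-sided) derivative of `φ` on
`[-h,0]` and is continuous there. -/
def IsC1Pair (n : ℕ) (h : ℝ) (φ φ' : ℝ → Euc n) : Prop :=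
  (∀ θ ∈ Icc (-h) (0:ℝ), HasDerivWithinAt φ (φ' θ) (Icc (-h) 0) θ) ∧
    ContinuousOn φ' (Icc (-h) 0)

/-- The norm of `W = C¹([-h,0];ℝⁿ)`:
`|φ|_W = max_{θ∈[-h,0]} ‖φ(θ)‖ + max_{θ∈[-h,0]} ‖φ'(θ)‖`. -/
def Wnorm (n : ℕ) (h : ℝ) (φ φ' : ℝ → Euc n) : ℝ :=
  (⨆ θ : Icc (-h) (0:ℝ), ‖φ θ.1‖) + ⨆ θ : Icc (-h) (0:ℝ), ‖φ' θ.1‖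

/-- A mild solution of `ü + k u̇ + A u + F(u) + M(u_t) = 0` on `[0,T)` with initial
datum `(φ, φ')`: `u` is `C¹` on `[-h,T)` with derivative `u'`, coincides with `φ` on
`[-h,0]`, and `u̇(t) = φ'(0) - ∫₀ᵗ (k u̇(s) + A u(s) + F(u(s)) + M(u_s)) ds` on `[0,T)`.
Here `M` takes the segment `u_s` as a pair (the function and its derivative). -/
def IsMildSolOn (n : ℕ) (h k T : ℝ) (A : Euc n →L[ℝ] Euc n) (F : Euc n → Euc n)
    (M : (ℝ → Euc n) → (ℝ → Euc n) → Euc n) (φ φ' u u' : ℝ → Euc n) : Prop :=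
  (∀ t ∈ Ico (-h) T, HasDerivWithinAt u (u' t) (Ico (-h) T) t) ∧
  ContinuousOn u' (Ico (-h) T) ∧
  (∀ θ ∈ Icc (-h) (0:ℝ), u θ = φ θ ∧ u' θ = φ' θ) ∧
  (∀ t ∈ Ico (0:ℝ) T, u' t = φ' 0 - ∫ s in (0:ℝ)..t,
      (k • u' s + A (u s) + F (u s) + M (fun θ => u (s + θ)) (fun θ => u' (s + θ))))

/-- A global mild solution (on `[0,∞)`). -/
def IsGlobalMildSol (n : ℕ) (h k : ℝ) (A : Euc n →L[ℝ] Euc n) (F : Euc n → Euc n)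
    (M : (ℝ → Euc n) → (ℝ → Euc n) → Euc n) (φ φ' u u' : ℝ → Euc n) : Prop :=
  (∀ t ∈ Ici (-h), HasDerivWithinAt u (u' t) (Ici (-h)) t) ∧
  ContinuousOn u' (Ici (-h)) ∧
  (∀ θ ∈ Icc (-h) (0:ℝ), u θ = φ θ ∧ u' θ = φ' θ) ∧
  (∀ t ∈ Ici (0:ℝ), u' t = φ' 0 - ∫ s in (0:ℝ)..t,
      (k • u' s + A (u s) + F (u s) + M (fun θ => u (s + θ)) (fun θ => u' (s + θ))))

/-- Hypothesis (M1): local Lipschitz property of the delay term in the `W`-norm. -/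
def HypM1 (n : ℕ) (h : ℝ) (M : (ℝ → Euc n) → (ℝ → Euc n) → Euc n) : Prop :=
  ∀ ρ > (0:ℝ), ∃ C > (0:ℝ), ∀ φ₁ φ₁' φ₂ φ₂' : ℝ → Euc n,
    IsC1Pair n h φ₁ φ₁' → IsC1Pair n h φ₂ φ₂' →
    Wnorm n h φ₁ φ₁' ≤ ρ → Wnorm n h φ₂ φ₂' ≤ ρ →
    ‖M φ₁ φ₁' - M φ₂ φ₂'‖ ≤ C * Wnorm n h (φ₁ - φ₂) (φ₁' - φ₂')

section Segments

variable {n : ℕ} {h : ℝ}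

lemma IsC1Pair.continuousOn {ψ ψ' : ℝ → Euc n} (hψ : IsC1Pair n h ψ ψ') :
    ContinuousOn ψ (Icc (-h) 0) :=
  fun θ hθ => (hψ.1 θ hθ).continuousWithinAt

lemma IsC1Pair.congr {ψ ψ' χ χ' : ℝ → Euc n} (hψ : IsC1Pair n h ψ ψ')
    (e : EqOn χ ψ (Icc (-h) 0)) (e' : EqOn χ' ψ' (Icc (-h) 0)) : IsC1Pair n h χ χ' := by
  refine ⟨fun θ hθ => ?_, hψ.2.congr e'⟩
  rw [e' hθ]
  exact (hψ.1 θ hθ).congr e (e hθ)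

lemma IsC1Pair.segment {u u' : ℝ → Euc n} (hu : ∀ t, HasDerivAt u (u' t) t)
    (hu' : Continuous u') (t : ℝ) :
    IsC1Pair n h (fun θ => u (t + θ)) (fun θ => u' (t + θ)) :=
  ⟨fun θ _ => ((hu (t + θ)).comp_const_add t θ).hasDerivWithinAt, by fun_prop⟩

lemma bddAbove_norm_of_continuousOn {f : ℝ → Euc n} (hf : ContinuousOn f (Icc (-h) 0)) :
    BddAbove (range fun θ : Icc (-h) (0 : ℝ) => ‖f θ.1‖) := by
  obtain ⟨C, hC⟩ := isCompact_Icc.exists_bound_of_continuousOn hf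
  exact ⟨C, by rintro _ ⟨θ, rfl⟩; exact hC θ θ.2⟩

lemma Wnorm_le (hh : 0 ≤ h) {ψ ψ' : ℝ → Euc n} {a b : ℝ}
    (ha : ∀ θ ∈ Icc (-h) (0 : ℝ), ‖ψ θ‖ ≤ a) (hb : ∀ θ ∈ Icc (-h) (0 : ℝ), ‖ψ' θ‖ ≤ b) :
    Wnorm n h ψ ψ' ≤ a + b := by
  have : Nonempty (Icc (-h) (0 : ℝ)) := ⟨⟨0, by simp [hh]⟩⟩
  exact add_le_add (ciSup_le fun θ => ha θ θ.2) (ciSup_le fun θ => hb θ θ.2)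

lemma Wnorm_nonneg {ψ ψ' : ℝ → Euc n} : 0 ≤ Wnorm n h ψ ψ' :=
  add_nonneg (Real.iSup_nonneg fun _ => norm_nonneg _) (Real.iSup_nonneg fun _ => norm_nonneg _)

lemma Wnorm_zero : Wnorm n h 0 0 = 0 := by simp [Wnorm]

lemma IsC1Pair.zero : IsC1Pair n h 0 0 :=
  ⟨fun θ _ => (hasDerivAt_const θ (0 : Euc n)).hasDerivWithinAt, continuousOn_const⟩

lemma norm_le_Wnorm {ψ ψ' : ℝ → Euc n} (hψ : ContinuousOn ψ (Icc (-h) 0)) {θ : ℝ}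
    (hθ : θ ∈ Icc (-h) (0 : ℝ)) : ‖ψ θ‖ ≤ Wnorm n h ψ ψ' :=
  (le_ciSup (bddAbove_norm_of_continuousOn hψ) ⟨θ, hθ⟩).trans
    (le_add_of_nonneg_right (Real.iSup_nonneg fun _ => norm_nonneg _))

lemma norm_deriv_le_Wnorm {ψ ψ' : ℝ → Euc n} (hψ' : ContinuousOn ψ' (Icc (-h) 0)) {θ : ℝ}
    (hθ : θ ∈ Icc (-h) (0 : ℝ)) : ‖ψ' θ‖ ≤ Wnorm n h ψ ψ' :=
  (le_ciSup (bddAbove_norm_of_continuousOn hψ') ⟨θ, hθ⟩).trans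
    (le_add_of_nonneg_left (Real.iSup_nonneg fun _ => norm_nonneg _))

lemma Wnorm_eq_norm_add_norm {ψ ψ' : ℝ → Euc n} (hψ : ContinuousOn ψ (Icc (-h) 0))
    (hψ' : ContinuousOn ψ' (Icc (-h) 0)) :
    Wnorm n h ψ ψ' = ‖(⟨_, hψ.domRestrict⟩ : C(Icc (-h) (0 : ℝ), Euc n))‖ +
      ‖(⟨_, hψ'.domRestrict⟩ : C(Icc (-h) (0 : ℝ), Euc n))‖ := by
  simp [Wnorm, ContinuousMap.norm_eq_iSup_norm]

lemma abs_Wnorm_sub_Wnorm_le {ψ ψ' χ χ' : ℝ → Euc n} (hψ : IsC1Pair n h ψ ψ')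
    (hχ : IsC1Pair n h χ χ') :
    |Wnorm n h ψ ψ' - Wnorm n h χ χ'| ≤ Wnorm n h (ψ - χ) (ψ' - χ') := by
  rw [Wnorm_eq_norm_add_norm hψ.continuousOn hψ.2, Wnorm_eq_norm_add_norm hχ.continuousOn hχ.2,
    Wnorm_eq_norm_add_norm (hψ.continuousOn.sub hχ.continuousOn) (hψ.2.sub hχ.2)]
  refine le_trans ?_ (add_le_add
    (abs_norm_sub_norm_le (⟨_, hψ.continuousOn.domRestrict⟩ : C(Icc (-h) (0 : ℝ), Euc n))
      ⟨_, hχ.continuousOn.domRestrict⟩)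
    (abs_norm_sub_norm_le (⟨_, hψ.2.domRestrict⟩ : C(Icc (-h) (0 : ℝ), Euc n)) ⟨_, hχ.2.domRestrict⟩))
  rw [add_sub_add_comm]
  exact abs_add_le _ _

lemma continuous_Wnorm_segment {u u' : ℝ → Euc n} (hu : Continuous u) (hu' : Continuous u') :
    Continuous fun t => Wnorm n h (fun θ => u (t + θ)) (fun θ => u' (t + θ)) := by
  have key : ∀ {f : ℝ → Euc n}, Continuous f →
      Continuous fun t => ⨆ θ : Icc (-h) (0 : ℝ), ‖f (t + θ.1)‖ := by
    intro f hf
    let g : C(ℝ × Icc (-h) (0 : ℝ), Euc n) := ⟨fun q => f (q.1 + q.2.1), by fun_prop⟩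
    have hg := g.curry.continuous.norm
    simp only [ContinuousMap.norm_eq_iSup_norm] at hg
    exact hg
  exact (key hu).add (key hu')

lemma tendsto_Wnorm_segment_sub {u u' : ℝ → Euc n} (hu : Continuous u) (hu' : Continuous u')
    (t₀ : ℝ) :
    Filter.Tendsto (fun t => Wnorm n h
      ((fun θ => u (t + θ)) - fun θ => u (t₀ + θ)) ((fun θ => u' (t + θ)) - fun θ => u' (t₀ + θ)))
      (nhds t₀) (nhds 0) := by
  have key : ∀ {f : ℝ → Euc n}, Continuous f →
      Filter.Tendsto (fun t => ⨆ θ : Icc (-h) (0 : ℝ), ‖f (t + θ.1) - f (t₀ + θ.1)‖)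
        (nhds t₀) (nhds 0) := by
    intro f hf
    let g : C(ℝ × Icc (-h) (0 : ℝ), Euc n) := ⟨fun q => f (q.1 + q.2.1), by fun_prop⟩
    have hg := tendsto_iff_norm_sub_tendsto_zero.1 (g.curry.continuous.tendsto t₀)
    simp only [ContinuousMap.norm_eq_iSup_norm] at hg
    exact hg
  simpa [Wnorm] using (key hu).add (key hu')

end Segments

section Functional

variable {n : ℕ} {h : ℝ} {N : (ℝ → Euc n) → (ℝ → Euc n) → Euc n}

lemma HypM1.congr (hN : HypM1 n h N) {ψ ψ' χ χ' : ℝ → Euc n} (hψ : IsC1Pair n h ψ ψ')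
    (e : EqOn χ ψ (Icc (-h) 0)) (e' : EqOn χ' ψ' (Icc (-h) 0)) : N χ χ' = N ψ ψ' := by
  have hχ := hψ.congr e e'
  obtain ⟨C, -, hC⟩ := hN (max (Wnorm n h χ χ') (Wnorm n h ψ ψ') + 1)
    (add_pos_of_nonneg_of_pos (le_max_of_le_left Wnorm_nonneg) one_pos)
  have h0 : Wnorm n h (χ - ψ) (χ' - ψ') = 0 := by
    have a : ∀ θ : Icc (-h) (0 : ℝ), ‖(χ - ψ) θ.1‖ = 0 := fun θ => by simp [e θ.2]
    have a' : ∀ θ : Icc (-h) (0 : ℝ), ‖(χ' - ψ') θ.1‖ = 0 := fun θ => by simp [e' θ.2]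
    simp only [Wnorm, a, a', Real.iSup_const_zero, add_zero]
  have := hC χ χ' ψ ψ' hχ hψ (by linarith [le_max_left (Wnorm n h χ χ') (Wnorm n h ψ ψ')])
    (by linarith [le_max_right (Wnorm n h χ χ') (Wnorm n h ψ ψ')])
  rw [h0, mul_zero] at this
  exact sub_eq_zero.1 (norm_le_zero_iff.1 this)

lemma HypM1.continuous_segment (hN : HypM1 n h N) {u u' : ℝ → Euc n}
    (hu : ∀ t, HasDerivAt u (u' t) t) (hu' : Continuous u') :
    Continuous fun t => N (fun θ => u (t + θ)) (fun θ => u' (t + θ)) := by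
  have hu_cont : Continuous u := continuous_iff_continuousAt.2 fun t => (hu t).continuousAt
  rw [continuous_iff_continuousAt]
  intro t₀
  set w := fun t => Wnorm n h (fun θ => u (t + θ)) (fun θ => u' (t + θ)) with hw
  have hwc : Continuous w := continuous_Wnorm_segment hu_cont hu'
  have hw0 : 0 ≤ w t₀ := Wnorm_nonneg
  obtain ⟨C, -, hC⟩ := hN (w t₀ + 1) (by linarith)
  have hlt : ∀ᶠ t in nhds t₀, w t < w t₀ + 1 :=
    hwc.continuousAt.eventually_lt continuousAt_const (by linarith)
  refine tendsto_iff_norm_sub_tendsto_zero.2 (squeeze_zero' (.of_forall fun _ => norm_nonneg _)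
    (hlt.mono fun t ht => hC _ _ _ _ (.segment hu hu' t) (.segment hu hu' t₀) ht.le ?_) ?_)
  · exact le_add_of_nonneg_right zero_le_one
  · simpa using (tendsto_Wnorm_segment_sub (h := h) hu_cont hu' t₀).const_mul C

/-- The functional `N` multiplied by a cutoff equal to one on the ball of radius `R` of `W` and
vanishing outside the ball of radius `R + 1`. -/
def truncate (n : ℕ) (h R : ℝ) (N : (ℝ → Euc n) → (ℝ → Euc n) → Euc n) (ψ ψ' : ℝ → Euc n) :
    Euc n :=
  max 0 (min 1 (R + 1 - Wnorm n h ψ ψ')) • N ψ ψ'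

lemma truncate_eq {R : ℝ} {ψ ψ' : ℝ → Euc n} (hR : Wnorm n h ψ ψ' ≤ R) :
    truncate n h R N ψ ψ' = N ψ ψ' := by
  rw [truncate, min_eq_left (by linarith), max_eq_right zero_le_one, one_smul]

lemma HypM1.exists_truncate_lipschitz (hN : HypM1 n h N) {R : ℝ} (hR : 0 ≤ R) :
    ∃ C > 0, ∀ ψ ψ' χ χ' : ℝ → Euc n, IsC1Pair n h ψ ψ' → IsC1Pair n h χ χ' →
      ‖truncate n h R N ψ ψ' - truncate n h R N χ χ'‖ ≤ C * Wnorm n h (ψ - χ) (ψ' - χ') := by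
  obtain ⟨C, hC0, hC⟩ := hN (R + 1) (by linarith)
  set B := ‖N 0 0‖ + C * (R + 1) with hB
  have hB0 : 0 ≤ B := by positivity
  have bound : ∀ ψ ψ' : ℝ → Euc n, IsC1Pair n h ψ ψ' → Wnorm n h ψ ψ' ≤ R + 1 →
      ‖N ψ ψ'‖ ≤ B := by
    intro ψ ψ' hψ hle
    have h1 := hC ψ ψ' 0 0 hψ .zero hle (by rw [Wnorm_zero]; linarith)
    rw [sub_zero, sub_zero] at h1
    have h2 : ‖N ψ ψ'‖ ≤ ‖N 0 0‖ + ‖N ψ ψ' - N 0 0‖ := norm_le_insert' _ _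
    have h3 := mul_le_mul_of_nonneg_left hle hC0.le
    linarith
  set c : ℝ → ℝ := fun r => max 0 (min 1 (R + 1 - r)) with hc
  have c0 : ∀ r, 0 ≤ c r := fun r => le_max_left _ _
  have c1 : ∀ r, c r ≤ 1 := fun r => max_le zero_le_one (min_le_left _ _)
  have cz : ∀ r, R + 1 ≤ r → c r = 0 := fun r hr =>
    max_eq_left ((min_le_right _ _).trans (by linarith))
  have clip : ∀ r s, |c r - c s| ≤ |r - s| := by
    intro r s
    have h1 := abs_max_sub_max_le_abs (min 1 (R + 1 - r)) (min 1 (R + 1 - s)) 0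
    have h2 := abs_min_sub_min_le_max 1 (R + 1 - r) 1 (R + 1 - s)
    rw [sub_self, abs_zero, max_eq_right (abs_nonneg _),
      show R + 1 - r - (R + 1 - s) = s - r by ring, abs_sub_comm s r] at h2
    simp only [hc, max_comm (0 : ℝ)]
    exact h1.trans h2
  have mixed : ∀ ψ ψ' χ χ' : ℝ → Euc n, IsC1Pair n h ψ ψ' → IsC1Pair n h χ χ' →
      Wnorm n h ψ ψ' ≤ R + 1 → ‖truncate n h R N ψ ψ' - truncate n h R N χ χ'‖
        ≤ (B + C) * Wnorm n h (ψ - χ) (ψ' - χ') := by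
    intro ψ ψ' χ χ' hψ hχ hle
    have hd : 0 ≤ Wnorm n h (ψ - χ) (ψ' - χ') := Wnorm_nonneg
    have hcd := (clip (Wnorm n h ψ ψ') (Wnorm n h χ χ')).trans (abs_Wnorm_sub_Wnorm_le hψ hχ)
    have e : truncate n h R N ψ ψ' - truncate n h R N χ χ' =
        (c (Wnorm n h ψ ψ') - c (Wnorm n h χ χ')) • N ψ ψ' +
          c (Wnorm n h χ χ') • (N ψ ψ' - N χ χ') := by
      simp only [truncate, hc, sub_smul, smul_sub]; abel
    have h1 : ‖(c (Wnorm n h ψ ψ') - c (Wnorm n h χ χ')) • N ψ ψ'‖ ≤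
        Wnorm n h (ψ - χ) (ψ' - χ') * B := by
      rw [norm_smul, Real.norm_eq_abs]
      exact mul_le_mul hcd (bound _ _ hψ hle) (norm_nonneg _) hd
    have h2 : ‖c (Wnorm n h χ χ') • (N ψ ψ' - N χ χ')‖ ≤ C * Wnorm n h (ψ - χ) (ψ' - χ') := by
      rw [norm_smul, Real.norm_eq_abs, abs_of_nonneg (c0 _)]
      rcases le_total (Wnorm n h χ χ') (R + 1) with hχle | hχle
      · calc _ ≤ 1 * (C * Wnorm n h (ψ - χ) (ψ' - χ')) :=
              mul_le_mul (c1 _) (hC _ _ _ _ hψ hχ hle hχle) (norm_nonneg _) zero_le_one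
          _ = _ := one_mul _
      · rw [cz _ hχle, zero_mul]; positivity
    rw [e]
    linarith [norm_add_le ((c (Wnorm n h ψ ψ') - c (Wnorm n h χ χ')) • N ψ ψ')
      (c (Wnorm n h χ χ') • (N ψ ψ' - N χ χ'))]
  refine ⟨B + C, by positivity, fun ψ ψ' χ χ' hψ hχ => ?_⟩
  rcases le_total (Wnorm n h ψ ψ') (R + 1) with hle | hle
  · exact mixed ψ ψ' χ χ' hψ hχ hle
  rcases le_total (Wnorm n h χ χ') (R + 1) with hle' | hle'
  · have h1 := mixed χ χ' ψ ψ' hχ hψ hle'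
    have h2 : Wnorm n h (χ - ψ) (χ' - ψ') = Wnorm n h (ψ - χ) (ψ' - χ') := by
      simp only [Wnorm, Pi.sub_apply, norm_sub_rev]
    rwa [norm_sub_rev, h2] at h1
  · have h1 := cz _ hle
    have h2 := cz _ hle'
    have hd : 0 ≤ Wnorm n h (ψ - χ) (ψ' - χ') := Wnorm_nonneg
    simp only [hc] at h1 h2
    simp only [truncate, h1, h2, zero_smul, sub_zero, norm_zero]
    positivity

lemma HypM1.truncate (hN : HypM1 n h N) {R : ℝ} (hR : 0 ≤ R) :
    HypM1 n h (truncate n h R N) := by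
  obtain ⟨C, hC0, hC⟩ := hN.exists_truncate_lipschitz hR
  exact fun _ _ => ⟨C, hC0, fun _ _ _ _ hψ hχ _ _ => hC _ _ _ _ hψ hχ⟩

/-- The delayed right-hand side `k ψ'(0) + A ψ(0) + F(ψ(0)) + M(ψ)` as a functional on `W`. -/
def totalForce (k : ℝ) (A : Euc n →L[ℝ] Euc n) (F : Euc n → Euc n)
    (M : (ℝ → Euc n) → (ℝ → Euc n) → Euc n) (ψ ψ' : ℝ → Euc n) : Euc n :=
  k • ψ' 0 + A (ψ 0) + F (ψ 0) + M ψ ψ'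

lemma hypM1_totalForce (hh : 0 ≤ h) {k : ℝ} {A : Euc n →L[ℝ] Euc n} {F : Euc n → Euc n}
    (hF : LocallyLipschitz F) {M : (ℝ → Euc n) → (ℝ → Euc n) → Euc n} (hM : HypM1 n h M) :
    HypM1 n h (totalForce k A F M) := by
  intro ρ hρ
  obtain ⟨C, hC0, hC⟩ := hM ρ hρ
  obtain ⟨K, hK⟩ := hF.locallyLipschitzOn.exists_lipschitzOnWith_of_compact
    (isCompact_closedBall (0 : Euc n) ρ)
  refine ⟨|k| + ‖A‖ + K + C, by positivity, fun ψ ψ' χ χ' hψ hχ hψρ hχρ => ?_⟩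
  have h0 : (0 : ℝ) ∈ Icc (-h) 0 := by simp [hh]
  set d := Wnorm n h (ψ - χ) (ψ' - χ') with hd
  have d0 : ‖ψ 0 - χ 0‖ ≤ d := norm_le_Wnorm (hψ.continuousOn.sub hχ.continuousOn) h0
  have d1 : ‖ψ' 0 - χ' 0‖ ≤ d := norm_deriv_le_Wnorm (hψ.2.sub hχ.2) h0
  have e : totalForce k A F M ψ ψ' - totalForce k A F M χ χ' =
      k • (ψ' 0 - χ' 0) + A (ψ 0 - χ 0) + (F (ψ 0) - F (χ 0)) + (M ψ ψ' - M χ χ') := by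
    simp only [totalForce, smul_sub, map_sub]; abel
  have i1 : ‖k • (ψ' 0 - χ' 0)‖ ≤ |k| * d := by
    rw [norm_smul, Real.norm_eq_abs]; gcongr
  have i2 : ‖A (ψ 0 - χ 0)‖ ≤ ‖A‖ * d := (A.le_opNorm _).trans (by gcongr)
  have i3 : ‖F (ψ 0) - F (χ 0)‖ ≤ K * d := by
    refine (hK.norm_sub_le ?_ ?_).trans (by gcongr)
    · simpa using (norm_le_Wnorm (ψ' := ψ') hψ.continuousOn h0).trans hψρ
    · simpa using (norm_le_Wnorm (ψ' := χ') hχ.continuousOn h0).trans hχρ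
  have i4 := hC ψ ψ' χ χ' hψ hχ hψρ hχρ
  rw [e]
  have := norm_add₄_le (a := k • (ψ' 0 - χ' 0)) (b := A (ψ 0 - χ 0)) (c := F (ψ 0) - F (χ 0))
    (d := M ψ ψ' - M χ χ')
  linarith

end Functional

section Volterra

lemma exists_unique_volterra {E : Type*} [NormedAddCommGroup E] [NormedSpace ℝ E] [CompleteSpace E]
    {T L : ℝ} (hT : 0 ≤ T) (hL : 0 < L) {G : (ℝ → E) → ℝ → E}
    (hGc : ∀ y, Continuous y → Continuous (G y))
    (hG : ∀ y z, Continuous y → Continuous z → ∀ t ∈ Icc 0 T,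
      ‖G y t - G z t‖ ≤ L * ∫ s in (0 : ℝ)..t, ‖y s - z s‖) :
    ∃ y, Continuous y ∧ EqOn y (G y) (Icc 0 T) ∧
      ∀ z, Continuous z → EqOn z (G z) (Icc 0 T) → EqOn z y (Icc 0 T) := by
  let lift : C(Icc 0 T, E) → ℝ → E := fun z t => exp (2 * L * t) • IccExtend hT z t
  have lift_cont : ∀ z, Continuous (lift z) := fun z => by
    have : Continuous (IccExtend hT z) := z.continuous.Icc_extend'
    fun_prop
  have lift_dist : ∀ z w s, ‖lift z s - lift w s‖ ≤ exp (2 * L * s) * dist z w := by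
    intro z w s
    simp only [lift, ← smul_sub, norm_smul, Real.norm_eq_abs, abs_exp, IccExtend, Function.comp]
    gcongr
    rw [← dist_eq_norm]
    exact ContinuousMap.dist_apply_le_dist _
  let Φ : C(Icc 0 T, E) → C(Icc 0 T, E) := fun z =>
    ⟨fun t => exp (-(2 * L * t)) • G (lift z) t, by
      have := hGc _ (lift_cont z)
      fun_prop⟩
  have hexp : ∀ t : ℝ, ∫ s in (0 : ℝ)..t, exp (2 * L * s) = (exp (2 * L * t) - 1) / (2 * L) := by
    intro t
    rw [intervalIntegral.integral_comp_mul_left (fun x => exp x) (by positivity)]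
    simp [div_eq_inv_mul]
  have hΦ : ContractingWith (1 / 2) Φ := by
    refine ⟨by rw [← NNReal.coe_lt_coe]; norm_num, LipschitzWith.of_dist_le_mul fun z w => ?_⟩
    refine (ContinuousMap.dist_le (by positivity)).2 fun t => ?_
    have h1 := hG _ _ (lift_cont z) (lift_cont w) t t.2
    have h2 : ∫ s in (0 : ℝ)..t, ‖lift z s - lift w s‖ ≤
        ∫ s in (0 : ℝ)..t, exp (2 * L * s) * dist z w :=
      intervalIntegral.integral_mono_on t.2.1
        (((lift_cont z).sub (lift_cont w)).norm.intervalIntegrable _ _)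
        (Continuous.intervalIntegrable (by fun_prop) _ _) fun s _ => lift_dist z w s
    rw [intervalIntegral.integral_mul_const, hexp] at h2
    have h3 : L * ∫ s in (0 : ℝ)..t, ‖lift z s - lift w s‖ ≤
        exp (2 * L * t) * (1 / 2 * dist z w) := by
      calc _ ≤ L * ((exp (2 * L * t) - 1) / (2 * L) * dist z w) := by gcongr
        _ = (exp (2 * L * t) - 1) * (1 / 2 * dist z w) := by field_simp
        _ ≤ _ := by gcongr; linarith
    simp only [Φ, ContinuousMap.coe_mk, dist_eq_norm, ← smul_sub, norm_smul, Real.norm_eq_abs,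
      abs_exp] at h1 h3 ⊢
    calc _ ≤ exp (-(2 * L * t)) * (exp (2 * L * t) * (1 / 2 * ‖z - w‖)) := by
          gcongr; exact h1.trans h3
      _ = _ := by rw [← mul_assoc, ← exp_add]; simp
  have apply_fixed : ∀ t (x y : E), exp (2 * L * t) • x = y ↔ x = exp (-(2 * L * t)) • y := by
    intro t x y
    constructor <;> rintro rfl <;> rw [smul_smul, ← exp_add] <;> simp
  have lift_eq : ∀ z (t : Icc 0 T), lift z t = exp (2 * L * t) • z t := by
    intro z t
    simp [lift]
  have : Nonempty C(Icc 0 T, E) := ⟨0⟩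
  refine ⟨lift hΦ.fixedPoint, lift_cont _, fun t ht => ?_, fun z hz hzG t ht => ?_⟩
  · rw [lift_eq _ ⟨t, ht⟩, apply_fixed]
    exact (DFunLike.congr_fun hΦ.fixedPoint_isFixedPt.eq ⟨t, ht⟩).symm
  · let w : C(Icc 0 T, E) := ⟨fun t => exp (-(2 * L * t)) • z t, by fun_prop⟩
    have hw : ∀ t ∈ Icc 0 T, lift w t = z t := fun t ht => by
      rw [lift_eq _ ⟨t, ht⟩, apply_fixed]
      rfl
    have hGw : ∀ t ∈ Icc 0 T, G (lift w) t = G z t := fun t ht => by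
      have h0 : ∫ s in (0 : ℝ)..t, ‖lift w s - z s‖ = 0 := by
        rw [intervalIntegral.integral_congr (g := fun _ => (0 : ℝ)) fun s hs => ?_]
        · simp
        · rw [uIcc_of_le ht.1] at hs
          simp [hw s ⟨hs.1, hs.2.trans ht.2⟩]
      have := hG _ _ (lift_cont w) hz t ht
      rw [h0, mul_zero] at this
      exact sub_eq_zero.1 (norm_le_zero_iff.1 this)
    have : Function.IsFixedPt Φ w := by
      ext1 t
      change exp (-(2 * L * t)) • G (lift w) t = exp (-(2 * L * t)) • z t
      rw [hGw t t.2, ← hzG t.2]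
    rw [← hΦ.fixedPoint_unique this, hw t ht]

end Volterra

section History

variable {n : ℕ} {h : ℝ} {φ φ' y z : ℝ → Euc n}

/-- The velocity with history `φ'` on `[-h,0]` and acceleration `y` on `[0,∞)`. -/
def velocityOf (h : ℝ) (φ' y : ℝ → Euc n) (t : ℝ) : Euc n :=
  φ' (max (-h) (min t 0)) + ∫ s in (0 : ℝ)..max t 0, y s

/-- The position with history `φ` on `[-h,0]` and acceleration `y` on `[0,∞)`. -/
def positionOf (h : ℝ) (φ φ' y : ℝ → Euc n) (t : ℝ) : Euc n :=
  φ 0 + ∫ s in (0 : ℝ)..t, velocityOf h φ' y s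

lemma continuous_velocityOf (hh : 0 ≤ h) (hφ' : ContinuousOn φ' (Icc (-h) 0)) (hy : Continuous y) :
    Continuous (velocityOf h φ' y) := by
  refine Continuous.add ?_ ?_
  · refine hφ'.comp_continuous (by fun_prop) fun t => ⟨le_max_left _ _, max_le (by linarith) ?_⟩
    exact min_le_right _ _
  · exact (intervalIntegral.continuous_primitive (fun a b => hy.intervalIntegrable a b) 0).comp
      (by fun_prop : Continuous fun t : ℝ => max t 0)

lemma hasDerivAt_positionOf (hh : 0 ≤ h) (hφ' : ContinuousOn φ' (Icc (-h) 0)) (hy : Continuous y)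
    (t : ℝ) : HasDerivAt (positionOf h φ φ' y) (velocityOf h φ' y t) t :=
  ((continuous_velocityOf hh hφ' hy).integral_hasStrictDerivAt 0 t).hasDerivAt.const_add _

lemma continuous_positionOf (hh : 0 ≤ h) (hφ' : ContinuousOn φ' (Icc (-h) 0)) (hy : Continuous y) :
    Continuous (positionOf h φ φ' y) :=
  continuous_iff_continuousAt.2 fun t => (hasDerivAt_positionOf hh hφ' hy t).continuousAt

lemma velocityOf_of_mem_history {t : ℝ} (ht : t ∈ Icc (-h) 0) : velocityOf h φ' y t = φ' t := by
  simp [velocityOf, ht.1, ht.2]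

lemma velocityOf_of_nonneg (hh : 0 ≤ h) {t : ℝ} (ht : 0 ≤ t) :
    velocityOf h φ' y t = φ' 0 + ∫ s in (0 : ℝ)..t, y s := by
  simp [velocityOf, ht, hh]

lemma hasDerivAt_velocityOf (hh : 0 ≤ h) (hy : Continuous y) {t : ℝ} (ht : 0 < t) :
    HasDerivAt (velocityOf h φ' y) (y t) t := by
  refine ((hy.integral_hasStrictDerivAt 0 t).hasDerivAt.const_add (φ' 0)).congr_of_eventuallyEq ?_
  filter_upwards [lt_mem_nhds ht] with s hs
  exact velocityOf_of_nonneg hh hs.le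

lemma positionOf_of_mem_history (hφ : IsC1Pair n h φ φ') {t : ℝ} (ht : t ∈ Icc (-h) 0) :
    positionOf h φ φ' y t = φ t := by
  have hsub : Icc t 0 ⊆ Icc (-h) 0 := Icc_subset_Icc_left ht.1
  have e : ∫ s in t..0, velocityOf h φ' y s = ∫ s in t..0, φ' s :=
    intervalIntegral.integral_congr fun s hs => velocityOf_of_mem_history <| hsub <| by
      rwa [uIcc_of_le ht.2] at hs
  have ftc : ∫ s in t..0, φ' s = φ 0 - φ t := by
    refine intervalIntegral.integral_eq_sub_of_hasDerivAt_of_le ht.2 (hφ.continuousOn.mono hsub)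
      (fun s hs => (hφ.1 s (hsub (Ioo_subset_Icc_self hs))).hasDerivAt
        (Icc_mem_nhds (ht.1.trans_lt hs.1) hs.2)) ?_
    refine ContinuousOn.intervalIntegrable ?_
    rw [uIcc_of_le ht.2]
    exact hφ.2.mono hsub
  rw [positionOf, intervalIntegral.integral_symm, e, ftc]
  abel

lemma velocityOf_congr {T : ℝ} (e : EqOn y z (Icc 0 T)) {t : ℝ} (ht : t ≤ T) (hT : 0 ≤ T) :
    velocityOf h φ' y t = velocityOf h φ' z t := by
  rw [velocityOf, velocityOf]
  congr 1
  refine intervalIntegral.integral_congr fun s hs => e ?_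
  rw [uIcc_of_le (le_max_right _ _)] at hs
  exact ⟨hs.1, hs.2.trans (max_le ht hT)⟩

lemma positionOf_congr {T : ℝ} (e : EqOn y z (Icc 0 T)) {t : ℝ} (ht : t ≤ T) (hT : 0 ≤ T) :
    positionOf h φ φ' y t = positionOf h φ φ' z t := by
  rw [positionOf, positionOf]
  congr 1
  refine intervalIntegral.integral_congr fun s hs => velocityOf_congr e ?_ hT
  exact (mem_uIcc.1 hs).elim (fun hs => hs.2.trans ht) fun hs => hs.2.trans hT

lemma norm_velocityOf_sub_le (hy : Continuous y) (hz : Continuous z) {t τ : ℝ} (ht : 0 ≤ t)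
    (hτ : τ ≤ t) :
    ‖velocityOf h φ' y τ - velocityOf h φ' z τ‖ ≤ ∫ s in (0 : ℝ)..t, ‖y s - z s‖ := by
  rw [velocityOf, velocityOf, add_sub_add_left_eq_sub, ← intervalIntegral.integral_sub
    (hy.intervalIntegrable _ _) (hz.intervalIntegrable _ _)]
  refine (intervalIntegral.norm_integral_le_integral_norm (le_max_right _ _)).trans ?_
  exact intervalIntegral.integral_mono_interval le_rfl (le_max_right _ _) (max_le hτ ht)
    (.of_forall fun _ => norm_nonneg _) ((hy.sub hz).norm.intervalIntegrable _ _)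

lemma norm_positionOf_sub_le (hh : 0 ≤ h) (hφ : IsC1Pair n h φ φ') (hy : Continuous y)
    (hz : Continuous z) {t τ : ℝ} (hτ : τ ∈ Icc (-h) t) (ht : 0 ≤ t) :
    ‖positionOf h φ φ' y τ - positionOf h φ φ' z τ‖ ≤ t * ∫ s in (0 : ℝ)..t, ‖y s - z s‖ := by
  have hI : 0 ≤ ∫ s in (0 : ℝ)..t, ‖y s - z s‖ :=
    intervalIntegral.integral_nonneg ht fun _ _ => norm_nonneg _
  rcases le_total τ 0 with hτ0 | hτ0
  · rw [positionOf_of_mem_history hφ ⟨hτ.1, hτ0⟩, positionOf_of_mem_history hφ ⟨hτ.1, hτ0⟩,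
      sub_self, norm_zero]
    positivity
  · rw [positionOf, positionOf, add_sub_add_left_eq_sub, ← intervalIntegral.integral_sub
      ((continuous_velocityOf hh hφ.2 hy).intervalIntegrable _ _)
      ((continuous_velocityOf hh hφ.2 hz).intervalIntegrable _ _)]
    refine (intervalIntegral.norm_integral_le_of_norm_le_const
      (C := ∫ s in (0 : ℝ)..t, ‖y s - z s‖) fun s hs => ?_).trans ?_
    · rw [uIoc_of_le hτ0] at hs
      exact norm_velocityOf_sub_le hy hz ht (hs.2.trans hτ.2)
    · rw [sub_zero, abs_of_nonneg hτ0, mul_comm]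
      exact mul_le_mul_of_nonneg_right hτ.2 hI

/-- The value of the functional `N` along the segment at time `t` of the motion with history
`(φ, φ')` and acceleration `y`. -/
def alongSegment (h : ℝ) (φ φ' : ℝ → Euc n) (N : (ℝ → Euc n) → (ℝ → Euc n) → Euc n)
    (y : ℝ → Euc n) (t : ℝ) : Euc n :=
  N (fun θ => positionOf h φ φ' y (t + θ)) (fun θ => velocityOf h φ' y (t + θ))

variable {N : (ℝ → Euc n) → (ℝ → Euc n) → Euc n}

lemma isC1Pair_segment (hh : 0 ≤ h) (hφ : IsC1Pair n h φ φ') (hy : Continuous y) (t : ℝ) :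
    IsC1Pair n h (fun θ => positionOf h φ φ' y (t + θ)) (fun θ => velocityOf h φ' y (t + θ)) :=
  .segment (hasDerivAt_positionOf hh hφ.2 hy) (continuous_velocityOf hh hφ.2 hy) t

lemma continuous_alongSegment (hh : 0 ≤ h) (hφ : IsC1Pair n h φ φ') (hN : HypM1 n h N)
    (hy : Continuous y) : Continuous (alongSegment h φ φ' N y) :=
  hN.continuous_segment (hasDerivAt_positionOf hh hφ.2 hy) (continuous_velocityOf hh hφ.2 hy)

lemma alongSegment_congr {T : ℝ} (e : EqOn y z (Icc 0 T)) {t : ℝ} (ht : t ∈ Icc 0 T)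
    (hh : 0 ≤ h) (hφ : IsC1Pair n h φ φ') (hN : HypM1 n h N) (hz : Continuous z) :
    alongSegment h φ φ' N y t = alongSegment h φ φ' N z t :=
  hN.congr (isC1Pair_segment hh hφ hz t)
    (fun θ hθ => positionOf_congr e (by linarith [hθ.2, ht.2]) (ht.1.trans ht.2))
    (fun θ hθ => velocityOf_congr e (by linarith [hθ.2, ht.2]) (ht.1.trans ht.2))

lemma exists_unique_truncated (hh : 0 ≤ h) (hφ : IsC1Pair n h φ φ') (hN : HypM1 n h N) {R T : ℝ}
    (hR : 0 ≤ R) (hT : 0 ≤ T) :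
    ∃ y, Continuous y ∧ EqOn y (-alongSegment h φ φ' (truncate n h R N) y) (Icc 0 T) ∧
      ∀ z, Continuous z → EqOn z (-alongSegment h φ φ' (truncate n h R N) z) (Icc 0 T) →
        EqOn z y (Icc 0 T) := by
  obtain ⟨C, hC0, hC⟩ := hN.exists_truncate_lipschitz hR
  refine exists_unique_volterra (L := C * (1 + T)) hT (by positivity)
    (G := fun y => -alongSegment h φ φ' (truncate n h R N) y)
    (fun y hy => (continuous_alongSegment hh hφ (hN.truncate hR) hy).neg) fun y z hy hz t ht => ?_
  have hI : 0 ≤ ∫ s in (0 : ℝ)..t, ‖y s - z s‖ :=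
    intervalIntegral.integral_nonneg ht.1 fun _ _ => norm_nonneg _
  simp only [Pi.neg_apply]
  rw [neg_sub_neg, norm_sub_rev]
  refine (hC _ _ _ _ (isC1Pair_segment hh hφ hy t) (isC1Pair_segment hh hφ hz t)).trans ?_
  rw [mul_assoc]
  refine mul_le_mul_of_nonneg_left ?_ hC0.le
  rw [add_mul, add_comm]
  refine (Wnorm_le hh (fun θ hθ => ?_) (fun θ hθ => ?_)).trans
    (add_le_add (mul_le_mul_of_nonneg_right ht.2 hI) (one_mul _).ge)
  · exact norm_positionOf_sub_le hh hφ hy hz ⟨by linarith [hθ.1, ht.1], by linarith [hθ.2]⟩ ht.1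
  · exact norm_velocityOf_sub_le hy hz ht.1 (by linarith [hθ.2])

lemma eqOn_of_eqOn_neg_alongSegment (hh : 0 ≤ h) (hφ : IsC1Pair n h φ φ') (hN : HypM1 n h N)
    {T : ℝ} (hT : 0 ≤ T) (hy : Continuous y) (hz : Continuous z)
    (hyN : EqOn y (-alongSegment h φ φ' N y) (Icc 0 T))
    (hzN : EqOn z (-alongSegment h φ φ' N z) (Icc 0 T)) : EqOn y z (Icc 0 T) := by
  have bound : ∀ {w : ℝ → Euc n}, Continuous w → ∃ R, ∀ t ∈ Icc 0 T, Wnorm n h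
      (fun θ => positionOf h φ φ' w (t + θ)) (fun θ => velocityOf h φ' w (t + θ)) ≤ R := by
    intro w hw
    obtain ⟨R, hR⟩ := isCompact_Icc.exists_bound_of_continuousOn
      (continuous_Wnorm_segment (h := h) (continuous_positionOf (φ := φ) hh hφ.2 hw)
        (continuous_velocityOf hh hφ.2 hw)).continuousOn (s := Icc 0 T)
    exact ⟨R, fun t ht => (le_abs_self _).trans (hR t ht)⟩
  obtain ⟨R₁, hR₁⟩ := bound hy
  obtain ⟨R₂, hR₂⟩ := bound hz
  have h0 : (0 : ℝ) ∈ Icc 0 T := ⟨le_rfl, hT⟩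
  obtain ⟨w, -, -, hw⟩ := exists_unique_truncated hh hφ hN (R := max R₁ R₂)
    (Wnorm_nonneg.trans ((hR₁ 0 h0).trans (le_max_left _ _))) hT
  have hyw := hw y hy fun t ht => by
    rw [Pi.neg_apply, alongSegment, truncate_eq ((hR₁ t ht).trans (le_max_left _ _))]
    exact hyN ht
  have hzw := hw z hz fun t ht => by
    rw [Pi.neg_apply, alongSegment, truncate_eq ((hR₂ t ht).trans (le_max_right _ _))]
    exact hzN ht
  exact hyw.trans hzw.symm

lemma exists_global_acceleration (hh : 0 ≤ h) (hφ : IsC1Pair n h φ φ') (hN : HypM1 n h N)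
    (loc : ∀ T : ℝ, 0 ≤ T → ∃ y, Continuous y ∧ EqOn y (-alongSegment h φ φ' N y) (Icc 0 T)) :
    ∃ y, Continuous y ∧ ∀ t, 0 ≤ t → y t = -alongSegment h φ φ' N y t := by
  choose Y hYc hY using fun m : ℕ => loc m m.cast_nonneg
  have agree : ∀ {m k : ℕ} {t : ℝ}, 0 ≤ t → t ≤ m → t ≤ k → Y m t = Y k t :=
    fun {m k t} h0 hm hk => eqOn_of_eqOn_neg_alongSegment hh hφ hN h0 (hYc m) (hYc k)
      ((hY m).mono (Icc_subset_Icc_right hm)) ((hY k).mono (Icc_subset_Icc_right hk))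
      ⟨h0, le_rfl⟩
  let y : ℝ → Euc n := fun t => Y ⌈max t 0⌉₊ (max t 0)
  have y_eq : ∀ (m : ℕ) (t : ℝ), t ≤ m → y t = Y m (max t 0) := fun m t ht =>
    agree (le_max_right _ _) (Nat.le_ceil _) (max_le ht m.cast_nonneg)
  have hyc : Continuous y := by
    refine continuous_iff_continuousAt.2 fun t => ?_
    obtain ⟨m, hm⟩ := exists_nat_gt t
    have : Continuous fun s : ℝ => Y m (max s 0) := (hYc m).comp (by fun_prop)
    refine this.continuousAt.congr ?_
    filter_upwards [gt_mem_nhds hm] with s hs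
    exact (y_eq m s hs.le).symm
  refine ⟨y, hyc, fun t ht => ?_⟩
  obtain ⟨m, hm⟩ := exists_nat_ge t
  have e : EqOn y (Y m) (Icc 0 m) := fun s hs => by rw [y_eq m s hs.2, max_eq_left hs.1]
  rw [alongSegment_congr e ⟨ht, hm⟩ hh hφ hN (hYc m), e ⟨ht, hm⟩]
  exact hY m ⟨ht, hm⟩

end History

section Energy

variable {n : ℕ} {A : Euc n →L[ℝ] Euc n} {F Fstar : Euc n → Euc n} {Pot : Euc n → ℝ}

/-- The mechanical energy of the state `(x, v)`, augmented by `‖x‖² / 2`. -/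
def energy (A : Euc n →L[ℝ] Euc n) (Pot : Euc n → ℝ) (x v : Euc n) : ℝ :=
  (‖v‖ ^ 2 + ⟪A x, x⟫ + ‖x‖ ^ 2) / 2 + Pot x

lemma hasDerivAt_energy (hA_symm : ∀ x y : Euc n, ⟪A x, y⟫ = ⟪x, A y⟫)
    (hF_grad : ∀ x : Euc n, HasGradientAt Pot (F x - Fstar x) x) {u u' : ℝ → Euc n} {a : Euc n}
    {t : ℝ} (hu : HasDerivAt u (u' t) t) (hu' : HasDerivAt u' a t) :
    HasDerivAt (fun t => energy A Pot (u t) (u' t))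
      (⟪u' t, a⟫ + ⟪A (u t), u' t⟫ + ⟪u t, u' t⟫ + ⟪F (u t) - Fstar (u t), u' t⟫) t := by
  have h1 := (((hu'.norm_sq.add ((A.hasFDerivAt.comp_hasDerivAt t hu).inner ℝ hu)).add
    hu.norm_sq).div_const 2).add ((hF_grad (u t)).hasFDerivAt.comp_hasDerivAt t hu)
  refine h1.congr_deriv ?_
  rw [InnerProductSpace.toDual_apply_apply, hA_symm (u' t), real_inner_comm (A (u t)) (u' t),
    Function.comp_apply]
  ring

lemma power_le {k c₀ Q : ℝ} (hk : 0 ≤ k) {x v m : Euc n} (hx : ‖x‖ ≤ √Q) (hv : ‖v‖ ≤ √Q)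
    (hQ : 0 ≤ Q) (hm : ‖m‖ + ‖Fstar x‖ ≤ c₀ * √Q) :
    ⟪v, -(k • v + A x + F x + m)⟫ + ⟪A x, v⟫ + ⟪x, v⟫ + ⟪F x - Fstar x, v⟫ ≤ (c₀ + 1) * Q := by
  have e : ⟪v, -(k • v + A x + F x + m)⟫ + ⟪A x, v⟫ + ⟪x, v⟫ + ⟪F x - Fstar x, v⟫ =
      -(k * ‖v‖ ^ 2) + ⟪x, v⟫ + ⟪-m, v⟫ + ⟪-Fstar x, v⟫ := by
    rw [real_inner_comm]
    simp only [inner_neg_left, inner_add_left, inner_sub_left, real_inner_smul_left,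
      real_inner_self_eq_norm_sq]
    ring
  have h1 := real_inner_le_norm x v
  have h2 := real_inner_le_norm (-m) v
  have h3 := real_inner_le_norm (-Fstar x) v
  rw [norm_neg] at h2 h3
  have h4 : (‖x‖ + ‖m‖ + ‖Fstar x‖) * ‖v‖ ≤ ((c₀ + 1) * √Q) * √Q :=
    mul_le_mul (by linarith) hv (norm_nonneg _)
      (by linarith [norm_nonneg x, norm_nonneg m, norm_nonneg (Fstar x)])
  rw [mul_assoc, Real.mul_self_sqrt hQ] at h4
  rw [e]
  nlinarith [mul_nonneg hk (sq_nonneg ‖v‖)]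

lemma le_four_mul_energy {Pot0 Pot1 : Euc n → ℝ} (hPot_split : ∀ x, Pot x = Pot0 x + Pot1 x)
    (hPot0_nonneg : ∀ x, 0 ≤ Pot0 x) {C : ℝ}
    (hC : ∀ x : Euc n, |Pot1 x| ≤ 1 / 4 * (⟪A x, x⟫ + Pot0 x) + C) (x v : Euc n) :
    ‖v‖ ^ 2 + ⟪A x, x⟫ + ‖x‖ ^ 2 ≤ 4 * (energy A Pot x v + C) := by
  rw [energy, hPot_split]
  linarith [neg_abs_le (Pot1 x), hC x, hPot0_nonneg x, sq_nonneg ‖v‖, sq_nonneg ‖x‖]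

lemma energy_barrier {h k : ℝ} (hh : 0 < h) (hk : 0 ≤ k)
    (hA_symm : ∀ x y : Euc n, ⟪A x, y⟫ = ⟪x, A y⟫) (hA_nonneg : ∀ x : Euc n, 0 ≤ ⟪A x, x⟫)
    {M : (ℝ → Euc n) → (ℝ → Euc n) → Euc n} {Pot0 Pot1 : Euc n → ℝ}
    (hF_grad : ∀ x : Euc n, HasGradientAt Pot (F x - Fstar x) x) {L : NNReal}
    (hFstar_lip : LipschitzWith L Fstar) (hPot_split : ∀ x, Pot x = Pot0 x + Pot1 x)
    (hPot0_nonneg : ∀ x, 0 ≤ Pot0 x) {C : ℝ}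
    (hC : ∀ x : Euc n, |Pot1 x| ≤ 1 / 4 * (⟪A x, x⟫ + Pot0 x) + C)
    {M₀ M₁ : ℝ} (hM₀ : 0 ≤ M₀) (hM₁ : 0 ≤ M₁)
    (hM2 : ∀ φ φ' : ℝ → Euc n, IsC1Pair n h φ φ' →
      ‖M φ φ'‖ ≤ M₀ + M₁ * ((⨆ θ : Icc (-h) (0 : ℝ), √⟪A (φ θ.1), φ θ.1⟫) +
        ⨆ θ : Icc (-h) (0 : ℝ), ‖φ' θ.1‖))
    {u u' y : ℝ → Euc n} (hu : ∀ t, HasDerivAt u (u' t) t) (hu' : Continuous u')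
    (hy : ∀ t, 0 < t → HasDerivAt u' (y t) t) {K c T : ℝ} (hT : 0 ≤ T)
    (hK : 1 ≤ K)
    (hc : c = M₀ + 2 * M₁ + ‖Fstar 0‖ + L + 1)
    (hhist : ∀ t ∈ Icc (-h) (0 : ℝ), ‖u' t‖ ^ 2 + ⟪A (u t), u t⟫ + ‖u t‖ ^ 2 ≤ K)
    (hinit : 4 * (energy A Pot (u 0) (u' 0) + C) < K / 2)
    (heq : ∀ t ∈ Icc 0 T,
      (∀ τ ∈ Icc (-h) t, ‖u' τ‖ ^ 2 + ⟪A (u τ), u τ⟫ + ‖u τ‖ ^ 2 ≤ K * exp (8 * c * T)) →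
      y t = -totalForce k A F M (fun θ => u (t + θ)) (fun θ => u' (t + θ))) :
    ∀ τ ∈ Icc (-h) T, ‖u' τ‖ ^ 2 + ⟪A (u τ), u τ⟫ + ‖u τ‖ ^ 2 ≤ K * exp (8 * c * T) := by
  set p : ℝ → ℝ := fun t => ‖u' t‖ ^ 2 + ⟪A (u t), u t⟫ + ‖u t‖ ^ 2 with hp
  have hu_cont : Continuous u := continuous_iff_continuousAt.2 fun t => (hu t).continuousAt
  have hpc : Continuous p := by fun_prop
  have hc0 : 0 ≤ c := by rw [hc]; positivity
  have hK0 : 0 ≤ K := zero_le_one.trans hK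
  have exp_mono : ∀ {s t : ℝ}, s ≤ t → K * exp (8 * c * s) ≤ K * exp (8 * c * t) := by
    intro s t hst
    gcongr
  have one_le : ∀ {t : ℝ}, 0 ≤ t → K ≤ K * exp (8 * c * t) := fun {t} ht => by
    simpa using exp_mono ht
  have hPot_cont : Continuous Pot :=
    continuous_iff_continuousAt.2 fun x => (hF_grad x).hasFDerivAt.continuousAt
  -- Growth of the energy as long as the barrier has not been crossed.
  have growth : ∀ t ∈ Icc 0 T, (∀ s ∈ Ico 0 t, p s ≤ K * exp (8 * c * s)) →
      p t < K * exp (8 * c * t) := by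
    intro t ht hbelow
    have hanti : AntitoneOn (fun s => energy A Pot (u s) (u' s) - K * exp (8 * c * s) / 8)
        (Icc 0 t) := by
      have hder : ∀ s ∈ Ioo 0 t, HasDerivAt
          (fun s => energy A Pot (u s) (u' s) - K * exp (8 * c * s) / 8)
          (⟪u' s, y s⟫ + ⟪A (u s), u' s⟫ + ⟪u s, u' s⟫ + ⟪F (u s) - Fstar (u s), u' s⟫ -
            c * (K * exp (8 * c * s))) s := by
        intro s hs
        have h1 := hasDerivAt_energy hA_symm hF_grad (hu s) (hy s hs.1)
        have h2 := ((((hasDerivAt_id s).const_mul (8 * c)).exp).const_mul K).div_const 8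
        refine (h1.sub h2).congr_deriv ?_
        simp only [id]
        ring
      refine antitoneOn_of_hasDerivWithinAt_nonpos (convex_Icc 0 t) ?_
        (fun s hs => (hder s (by rwa [interior_Icc] at hs)).hasDerivWithinAt) fun s hs => ?_
      · simp only [energy]
        fun_prop
      rw [interior_Icc] at hs
      set Q := K * exp (8 * c * s) with hQ
      have hQ1 : 1 ≤ Q := hK.trans (one_le hs.1.le)
      have hsQ : 1 ≤ √Q := Real.one_le_sqrt.2 hQ1
      have hpQ : ∀ τ ∈ Icc (-h) s, p τ ≤ Q := by
        intro τ hτ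
        rcases le_total τ 0 with h0 | h0
        · exact (hhist τ ⟨hτ.1, h0⟩).trans (one_le hs.1.le)
        · exact (hbelow τ ⟨h0, hτ.2.trans_lt hs.2⟩).trans (exp_mono hτ.2)
      have hvQ : ∀ τ ∈ Icc (-h) s, ‖u' τ‖ ≤ √Q := fun τ hτ => Real.le_sqrt_of_sq_le <| by
        have := hpQ τ hτ
        simp only [hp] at this
        linarith [hA_nonneg (u τ), sq_nonneg ‖u τ‖]
      have hxQ : ∀ τ ∈ Icc (-h) s, ‖u τ‖ ≤ √Q := fun τ hτ => Real.le_sqrt_of_sq_le <| by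
        have := hpQ τ hτ
        simp only [hp] at this
        linarith [hA_nonneg (u τ), sq_nonneg ‖u' τ‖]
      have hAQ : ∀ τ ∈ Icc (-h) s, √⟪A (u τ), u τ⟫ ≤ √Q := fun τ hτ => Real.sqrt_le_sqrt <| by
        have := hpQ τ hτ
        simp only [hp] at this
        linarith [sq_nonneg ‖u τ‖, sq_nonneg ‖u' τ‖]
      have hseg : ∀ θ : Icc (-h) (0 : ℝ), s + θ.1 ∈ Icc (-h) s := fun θ =>
        ⟨by linarith [θ.2.1, hs.1], by linarith [θ.2.2]⟩
      have hs' : s ∈ Icc (-h) s := ⟨by linarith [hs.1], le_rfl⟩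
      have : Nonempty (Icc (-h) (0 : ℝ)) := ⟨⟨0, by simp [hh.le]⟩⟩
      have hMs : ‖M (fun θ => u (s + θ)) (fun θ => u' (s + θ))‖ ≤ (M₀ + 2 * M₁) * √Q := by
        refine (hM2 _ _ (.segment hu hu' s)).trans ?_
        have h1 : (⨆ θ : Icc (-h) (0 : ℝ), √⟪A (u (s + θ.1)), u (s + θ.1)⟫) +
            ⨆ θ : Icc (-h) (0 : ℝ), ‖u' (s + θ.1)‖ ≤ √Q + √Q :=
          add_le_add (ciSup_le fun θ => hAQ _ (hseg θ)) (ciSup_le fun θ => hvQ _ (hseg θ))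
        have h2 := mul_le_mul_of_nonneg_left h1 hM₁
        have h3 := mul_le_mul_of_nonneg_left hsQ hM₀
        linarith
      have hFs : ‖Fstar (u s)‖ ≤ (‖Fstar 0‖ + L) * √Q := by
        have h1 := hFstar_lip.norm_sub_le (u s) 0
        rw [sub_zero] at h1
        have h2 := mul_le_mul_of_nonneg_left (hxQ s hs') L.coe_nonneg
        have h3 := mul_le_mul_of_nonneg_left hsQ (norm_nonneg (Fstar 0))
        linarith [norm_le_insert' (Fstar (u s)) (Fstar 0)]
      have hys := heq s ⟨hs.1.le, hs.2.le.trans ht.2⟩ fun τ hτ =>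
        (hpQ τ hτ).trans (exp_mono (hs.2.le.trans ht.2))
      simp only [totalForce, add_zero] at hys
      have hpow := power_le (A := A) (F := F) (Fstar := Fstar) (k := k)
        (c₀ := M₀ + 2 * M₁ + ‖Fstar 0‖ + L) hk (hxQ s hs') (hvQ s hs') (zero_le_one.trans hQ1)
        (m := M (fun θ => u (s + θ)) (fun θ => u' (s + θ))) (by linarith)
      rw [hys, hc]
      linarith
    have h1 := hanti (left_mem_Icc.2 ht.1) (right_mem_Icc.2 ht.1) ht.1
    simp only [mul_zero, exp_zero, mul_one] at h1
    have h2 : p t ≤ _ := le_four_mul_energy hPot_split hPot0_nonneg hC (u t) (u' t)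
    linarith [one_le ht.1]
  have below : ∀ t ∈ Icc 0 T, p t < K * exp (8 * c * t) := by
    by_contra! hex
    set S := Icc 0 T ∩ {t | K * exp (8 * c * t) ≤ p t} with hS
    have hSc : IsCompact S := isCompact_Icc.inter_right (isClosed_le (by fun_prop) hpc)
    have hSn : S.Nonempty := hex
    have hmem := hSc.sInf_mem hSn
    refine (growth _ hmem.1 fun s hs => ?_).not_ge hmem.2
    by_contra! hlt
    exact (csInf_le hSc.bddBelow ⟨⟨hs.1, hs.2.le.trans hmem.1.2⟩, hlt.le⟩).not_gt hs.2
  intro τ hτ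
  rcases le_total τ 0 with h0 | h0
  · exact (hhist τ ⟨hτ.1, h0⟩).trans (one_le hT)
  · exact (below τ ⟨h0, hτ.2⟩).le.trans (exp_mono hτ.2)

end Energy

section Solutions

variable {n : ℕ} {h k : ℝ} {A : Euc n →L[ℝ] Euc n} {F : Euc n → Euc n}
  {M : (ℝ → Euc n) → (ℝ → Euc n) → Euc n} {φ φ' y : ℝ → Euc n}

lemma isGlobalMildSol_of_acceleration (hh : 0 ≤ h) (hφ : IsC1Pair n h φ φ') (hy : Continuous y)
    (hyN : ∀ t, 0 ≤ t → y t = -alongSegment h φ φ' (totalForce k A F M) y t) :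
    IsGlobalMildSol n h k A F M φ φ' (positionOf h φ φ' y) (velocityOf h φ' y) := by
  refine ⟨fun t _ => (hasDerivAt_positionOf hh hφ.2 hy t).hasDerivWithinAt,
    (continuous_velocityOf hh hφ.2 hy).continuousOn,
    fun θ hθ => ⟨positionOf_of_mem_history hφ hθ, velocityOf_of_mem_history hθ⟩, fun t ht => ?_⟩
  rw [velocityOf_of_nonneg hh ht, sub_eq_add_neg, ← intervalIntegral.integral_neg]
  congr 1
  refine intervalIntegral.integral_congr fun s hs => ?_
  rw [uIcc_of_le ht] at hs
  rw [hyN s hs.1]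
  simp [alongSegment, totalForce]

lemma IsGlobalMildSol.exists_acceleration (hh : 0 ≤ h)
    (hN : HypM1 n h (totalForce k A F M)) {v v' : ℝ → Euc n}
    (hv : IsGlobalMildSol n h k A F M φ φ' v v') :
    ∃ y, Continuous y ∧ (∀ t, 0 ≤ t → y t = -alongSegment h φ φ' (totalForce k A F M) y t) ∧
      EqOn v (positionOf h φ φ' y) (Ici (-h)) := by
  obtain ⟨hder, hcont, hhist, hint⟩ := hv
  have h0 : (0 : ℝ) ∈ Icc (-h) 0 := by simp [hh]
  let V' : ℝ → Euc n := fun t => v' (max t (-h))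
  let V : ℝ → Euc n := fun t => φ 0 + ∫ s in (0 : ℝ)..t, V' s
  have hV'c : Continuous V' := hcont.comp_continuous (by fun_prop) fun t =>
    mem_Ici.2 (le_max_right _ _)
  have hV : ∀ t, HasDerivAt V (V' t) t := fun t =>
    (hV'c.integral_hasStrictDerivAt 0 t).hasDerivAt.const_add _
  have hV'v : EqOn v' V' (Ici (-h)) := fun t ht => by
    simp only [V', max_eq_left (mem_Ici.1 ht)]
  have hVv : EqOn v V (Ici (-h)) := by
    intro t ht
    have hsub : uIcc 0 t ⊆ Ici (-h) := fun s hs => by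
      rcases mem_uIcc.1 hs with hs | hs
      · exact h0.1.trans hs.1
      · exact (mem_Ici.1 ht).trans hs.1
    have ftc : ∫ s in (0 : ℝ)..t, V' s = v t - v 0 := by
      refine intervalIntegral.integral_eq_sub_of_hasDeriv_right
        (fun s hs => (hder s (hsub hs)).continuousWithinAt.mono hsub) (fun s hs => ?_)
        (hV'c.intervalIntegrable _ _)
      have hs' : s ∈ Ici (-h) := hsub (Ioo_subset_Icc_self hs)
      rw [← hV'v hs']
      exact (hder s hs').mono fun r hr => hs'.trans (mem_Ioi.1 hr).le
    simp only [V, ftc, (hhist 0 h0).1]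
    abel
  set y : ℝ → Euc n := fun t =>
    -totalForce k A F M (fun θ => V (t + θ)) (fun θ => V' (t + θ)) with hy
  have hyc : Continuous y := (hN.continuous_segment hV hV'c).neg
  have hseg : ∀ s, 0 ≤ s → ∀ θ ∈ Icc (-h) 0, s + θ ∈ Ici (-h) := fun s hs θ hθ => by
    simp only [mem_Ici]
    linarith [hθ.1]
  have hvel : EqOn (velocityOf h φ' y) V' (Ici (-h)) := by
    intro t ht
    rcases le_total t 0 with ht0 | ht0
    · rw [velocityOf_of_mem_history ⟨ht, ht0⟩, ← hV'v ht, (hhist t ⟨ht, ht0⟩).2]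
    · rw [velocityOf_of_nonneg hh ht0, ← hV'v ht, hint t ht0, sub_eq_add_neg,
        ← intervalIntegral.integral_neg]
      congr 1
      refine intervalIntegral.integral_congr fun s hs => ?_
      rw [uIcc_of_le ht0] at hs
      simp only [hy]
      rw [← hN.congr (.segment hV hV'c s) (fun θ hθ => hVv (hseg s hs.1 θ hθ))
        (fun θ hθ => hV'v (hseg s hs.1 θ hθ))]
      simp [totalForce]
  have hpos : EqOn (positionOf h φ φ' y) V (Ici (-h)) := by
    intro t ht
    simp only [positionOf, V]
    congr 1
    refine intervalIntegral.integral_congr fun s hs => hvel ?_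
    rcases mem_uIcc.1 hs with hs | hs
    · exact h0.1.trans hs.1
    · exact (mem_Ici.1 ht).trans hs.1
  refine ⟨y, hyc, fun t ht => ?_, fun t ht => (hVv ht).trans (hpos ht).symm⟩
  rw [alongSegment, hN.congr (.segment hV hV'c t) (fun θ hθ => hpos (hseg t ht θ hθ))
    (fun θ hθ => hvel (hseg t ht θ hθ))]

end Solutions

/-- Global well-posedness: existence and uniqueness of a global mild
solution for every initial datum in `W`. -/
theorem global_existence_and_uniqueness
    (n : ℕ) (hn : 1 ≤ n) (h k : ℝ) (hh : 0 < h) (hk : 0 < k)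
    (A : Euc n →L[ℝ] Euc n)
    (hA_symm : ∀ x y : Euc n, ⟪A x, y⟫ = ⟪x, A y⟫)
    (hA_pos : ∀ x : Euc n, x ≠ 0 → 0 < ⟪A x, x⟫)
    (F : Euc n → Euc n) (hF1 : LocallyLipschitz F)
    (M : (ℝ → Euc n) → (ℝ → Euc n) → Euc n)
    (hM1 : HypM1 n h M)
    -- Hypothesis (F2)
    (Pot Pot0 Pot1 : Euc n → ℝ) (Fstar : Euc n → Euc n)
    (hPot_smooth : ContDiff ℝ 1 Pot)
    (hF_grad : ∀ x : Euc n, HasGradientAt Pot (F x - Fstar x) x)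
    (L_Fstar : NNReal) (hFstar_lip : LipschitzWith L_Fstar Fstar)
    (hPot_split : ∀ x, Pot x = Pot0 x + Pot1 x)
    (hPot0_nonneg : ∀ x, 0 ≤ Pot0 x)
    (hPot1_bound : ∀ η > (0:ℝ), ∃ C > (0:ℝ), ∀ x : Euc n,
      |Pot1 x| ≤ η * (⟪A x, x⟫ + Pot0 x) + C)
    -- Hypothesis (M2)
    (M₀ M₁ : ℝ) (hM₀ : 0 ≤ M₀) (hM₁ : 0 ≤ M₁)
    (hM2 : ∀ φ φ' : ℝ → Euc n, IsC1Pair n h φ φ' →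
      ‖M φ φ'‖ ≤ M₀ + M₁ * ((⨆ θ : Icc (-h) (0:ℝ), Real.sqrt ⟪A (φ θ.1), φ θ.1⟫) +
        ⨆ θ : Icc (-h) (0:ℝ), ‖φ' θ.1‖))
    (φ φ' : ℝ → Euc n) (hφ : IsC1Pair n h φ φ') :
    ∃ u u' : ℝ → Euc n, IsGlobalMildSol n h k A F M φ φ' u u' ∧
      ∀ v v' : ℝ → Euc n, IsGlobalMildSol n h k A F M φ φ' v v' →
        ∀ t ∈ Ici (-h), v t = u t := by
  have hN : HypM1 n h (totalForce k A F M) := hypM1_totalForce hh.le hF1 hM1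
  have hA_nonneg : ∀ x : Euc n, 0 ≤ ⟪A x, x⟫ := fun x => by
    rcases eq_or_ne x 0 with rfl | hx
    · simp
    · exact (hA_pos x hx).le
  obtain ⟨C, -, hC⟩ := hPot1_bound (1 / 4) (by norm_num)
  obtain ⟨B, hB⟩ := isCompact_Icc.exists_bound_of_continuousOn (s := Icc (-h) (0 : ℝ))
    (f := fun t => ‖φ' t‖ ^ 2 + ⟪A (φ t), φ t⟫ + ‖φ t‖ ^ 2)
    (by have h1 := hφ.2; have h2 := hφ.continuousOn; fun_prop)
  set K := max (max 1 B) (8 * (energy A Pot (φ 0) (φ' 0) + C) + 1) with hK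
  set c := M₀ + 2 * M₁ + ‖Fstar 0‖ + L_Fstar + 1 with hc
  have hK1 : 1 ≤ K := (le_max_left _ _).trans (le_max_left _ _)
  have h0 : (0 : ℝ) ∈ Icc (-h) 0 := by simp [hh.le]
  have loc : ∀ T : ℝ, 0 ≤ T → ∃ y, Continuous y ∧
      EqOn y (-alongSegment h φ φ' (totalForce k A F M) y) (Icc 0 T) := by
    intro T hT
    set Q := K * exp (8 * c * T) with hQ
    obtain ⟨y, hyc, hy, -⟩ := exists_unique_truncated (R := √Q + √Q) hh.le hφ hN
      (by positivity) hT
    have heq : ∀ t ∈ Icc 0 T, (∀ τ ∈ Icc (-h) t, ‖velocityOf h φ' y τ‖ ^ 2 +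
        ⟪A (positionOf h φ φ' y τ), positionOf h φ φ' y τ⟫ + ‖positionOf h φ φ' y τ‖ ^ 2 ≤ Q) →
        y t = -alongSegment h φ φ' (totalForce k A F M) y t := by
      intro t ht hle
      rw [hy ht, Pi.neg_apply, alongSegment, alongSegment, truncate_eq]
      refine Wnorm_le hh.le (fun θ hθ => ?_) fun θ hθ => ?_ <;>
      · have hτ := hle (t + θ) ⟨by linarith [hθ.1, ht.1], by linarith [hθ.2]⟩
        have hA := hA_nonneg (positionOf h φ φ' y (t + θ))
        refine Real.le_sqrt_of_sq_le ?_
        linarith [sq_nonneg ‖velocityOf h φ' y (t + θ)‖,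
          sq_nonneg ‖positionOf h φ φ' y (t + θ)‖]
    have hbar := energy_barrier hh hk.le hA_symm hA_nonneg hF_grad hFstar_lip hPot_split
      hPot0_nonneg hC hM₀ hM₁ hM2 (hasDerivAt_positionOf (φ := φ) hh.le hφ.2 hyc)
      (continuous_velocityOf hh.le hφ.2 hyc) (fun t ht => hasDerivAt_velocityOf hh.le hyc ht)
      hT hK1 hc (fun t ht => ?_) ?_ heq
    · exact ⟨y, hyc, fun t ht => heq t ht fun τ hτ => hbar τ ⟨hτ.1, hτ.2.trans ht.2⟩⟩
    · rw [positionOf_of_mem_history hφ ht, velocityOf_of_mem_history ht]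
      exact (le_abs_self _).trans ((hB t ht).trans ((le_max_right _ _).trans (le_max_left _ _)))
    · rw [positionOf_of_mem_history hφ h0, velocityOf_of_mem_history h0]
      linarith [le_max_right (max 1 B) (8 * (energy A Pot (φ 0) (φ' 0) + C) + 1)]
  obtain ⟨y, hyc, hy⟩ := exists_global_acceleration hh.le hφ hN loc
  refine ⟨_, _, isGlobalMildSol_of_acceleration hh.le hφ hyc hy, fun v v' hv t ht => ?_⟩
  obtain ⟨z, hzc, hz, hvz⟩ := hv.exists_acceleration hh.le hN
  rw [hvz ht]
  exact positionOf_congr (eqOn_of_eqOn_neg_alongSegment hh.le hφ hN (le_max_right t 0) hzc hyc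
    (fun s hs => hz s hs.1) fun s hs => hy s hs.1) (le_max_left t 0) (le_max_right t 0)
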